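/- If a quadratic form q over a field k of characteristic ≠ 2 is an I^n-neighbor of complementary dimension r and 2^n > dim q + r, then i_W(q) ≥ (dim q − r)/2; in particular, q is isotropic. -/

import Mathlib

/-!  Diagonal quadratic forms over a field of characteristic ≠ 2.
In characteristic ≠ 2 every regular quadratic form is isometric to a diagonal form
`⟨d 1, …, d n⟩`, so we model (regular) quadratic forms by their diagonal
coefficient functions. -/

/-- The diagonal quadratic form `⟨d i⟩_{i : ι}` over `k`. -/
noncomputable def diagQF (k : Type) [Field k] {ι : Type} [Fintype ι] (d : ι → k) :
    QuadraticForm k (ι → k) :=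
  QuadraticMap.weightedSumSquares k d

/-- Isometry of (diagonal) quadratic forms. -/
def FormIsom (k : Type) [Field k] {ι κ : Type} [Fintype ι] [Fintype κ]
    (d : ι → k) (e : κ → k) : Prop :=
  QuadraticMap.Equivalent (diagQF k d) (diagQF k e)

/-- The orthogonal sum of `m` copies of the hyperbolic plane `⟨1, -1⟩`. -/
def hypForm (k : Type) [Field k] (m : ℕ) : Fin (2 * m) → k :=
  fun j => if j.val % 2 = 0 then 1 else -1

/-- The Witt index of a (diagonal) form: the largest `m` such that the form is isometric
to `m·ℍ ⟂ (rest)` for some diagonal form `rest`. -/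
noncomputable def wittIndex (k : Type) [Field k] {ι : Type} [Fintype ι] (d : ι → k) : ℕ :=
  sSup {m : ℕ | ∃ (s : ℕ) (e : Fin s → k), FormIsom k d (Sum.elim (hypForm k m) e)}
/-- Witt equivalence of (diagonal) quadratic forms: the two forms become isometric after
adding suitable numbers of hyperbolic planes. -/
def wittEquiv (k : Type) [Field k] {ι κ : Type} [Fintype ι] [Fintype κ]
    (d : ι → k) (e : κ → k) : Prop :=
  ∃ a b : ℕ, FormIsom k (Sum.elim d (hypForm k a)) (Sum.elim e (hypForm k b))

/-- The Witt class of a (diagonal) form lies in `I^n(k)`, the `n`-th power of the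
fundamental ideal of the Witt ring: equivalently (since `I^n(k)` is additively generated
by the `n`-fold Pfister forms, and `-⟨⟨a₁,…,aₙ⟩⟩ = ⟨-1⟩·⟨⟨a₁,…,aₙ⟩⟩` in the Witt ring),
the form is Witt equivalent to an orthogonal sum of scaled `n`-fold Pfister forms
`c_s · ⟨⟨a_{s,1}, …, a_{s,n}⟩⟩`.  The diagonal entries of `⟨⟨a₁,…,aₙ⟩⟩` are indexed by
the subsets `S ⊆ {1,…,n}`, with entry `∏_{u ∈ S} a_u`. -/
def inIpow (k : Type) [Field k] (n : ℕ) {ι : Type} [Fintype ι] (d : ι → k) : Prop :=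
  ∃ (t : ℕ) (c : Fin t → k) (a : Fin t → Fin n → k),
    (∀ s, c s ≠ 0) ∧ (∀ s u, a s u ≠ 0) ∧
    wittEquiv k d (fun p : Fin t × Finset (Fin n) => c p.1 * ∏ u ∈ p.2, a p.1 u)

/-- `q` is an `I^n`-neighbor of complementary dimension `r`: there exists an
`r`-dimensional (regular) form `σ` with `0 ≤ r < dim q` such that the Witt class of
`q ⟂ σ` lies in `I^n(k)`. -/
def isIneighbor (k : Type) [Field k] (n : ℕ) {m : ℕ} (d : Fin m → k) (r : ℕ) : Prop :=
  r < m ∧ ∃ σ : Fin r → k, (∀ t, σ t ≠ 0) ∧ inIpow k n (Sum.elim d σ)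

namespace HS


section basics
variable {R : Type} [CommRing R] {ι : Type} [Fintype ι]

def bf (d x y : ι → R) : R := ∑ i, d i * x i * y i
def qf (d x : ι → R) : R := ∑ i, d i * x i * x i

lemma bf_self (d x : ι → R) : bf d x x = qf d x := rfl
lemma bf_comm (d x y : ι → R) : bf d x y = bf d y x := by
  unfold bf; exact Finset.sum_congr rfl fun i _ => by ring
lemma bf_add_left (d x y z : ι → R) : bf d (x + y) z = bf d x z + bf d y z := by
  unfold bf; rw [← Finset.sum_add_distrib]
  exact Finset.sum_congr rfl fun i _ => by simp only [Pi.add_apply]; ring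
lemma bf_smul_left (a : R) (d x z : ι → R) : bf d (a • x) z = a * bf d x z := by
  unfold bf; rw [Finset.mul_sum]
  exact Finset.sum_congr rfl fun i _ => by simp only [Pi.smul_apply, smul_eq_mul]; ring
lemma bf_add_right (d x y z : ι → R) : bf d z (x + y) = bf d z x + bf d z y := by
  rw [bf_comm, bf_add_left, bf_comm d x, bf_comm d y]
lemma bf_smul_right (a : R) (d x z : ι → R) : bf d z (a • x) = a * bf d z x := by
  rw [bf_comm, bf_smul_left, bf_comm d x]
lemma bf_zero_left (d z : ι → R) : bf d 0 z = 0 := by simp [bf]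
lemma bf_zero_right (d z : ι → R) : bf d z 0 = 0 := by simp [bf]
lemma bf_neg_left (d x z : ι → R) : bf d (-x) z = - bf d x z := by
  simp [bf]
lemma bf_neg_right (d x z : ι → R) : bf d z (-x) = - bf d z x := by
  simp [bf]
lemma bf_sub_left (d x y z : ι → R) : bf d (x - y) z = bf d x z - bf d y z := by
  rw [sub_eq_add_neg, bf_add_left, bf_neg_left, sub_eq_add_neg]
lemma bf_sub_right (d x y z : ι → R) : bf d z (x - y) = bf d z x - bf d z y := by
  rw [sub_eq_add_neg, bf_add_right, bf_neg_right, sub_eq_add_neg]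
lemma qf_smul (a : R) (d x : ι → R) : qf d (a • x) = a ^ 2 * qf d x := by
  rw [← bf_self, bf_smul_left, bf_smul_right, bf_self]; ring
lemma qf_add (d x y : ι → R) : qf d (x + y) = qf d x + qf d y + 2 * bf d x y := by
  rw [← bf_self, bf_add_left, bf_add_right, bf_add_right, bf_self, bf_self, bf_comm d y x]; ring
lemma qf_sub (d x y : ι → R) : qf d (x - y) = qf d x + qf d y - 2 * bf d x y := by
  rw [← bf_self, bf_sub_left, bf_sub_right, bf_sub_right, bf_self, bf_self, bf_comm d y x]; ring
lemma qf_zero (d : ι → R) : qf d 0 = 0 := by simp [qf]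

lemma bf_map {S : Type} [CommRing S] (f : R →+* S) (d x y : ι → R) :
    bf (fun i => f (d i)) (fun i => f (x i)) (fun i => f (y i)) = f (bf d x y) := by
  simp [bf]
lemma qf_map {S : Type} [CommRing S] (f : R →+* S) (d x : ι → R) :
    qf (fun i => f (d i)) (fun i => f (x i)) = f (qf d x) := by
  simp [qf]

def Aniso (d : ι → R) : Prop := ∀ x, qf d x = 0 → x = 0
end basics

section CP
open Polynomial
variable {F : Type} [Field F] {ι : Type} [Fintype ι]

lemma coeff_qf (d : ι → F) (p : ι → F[X]) (D : ℕ) (h : ∀ i, (p i).natDegree ≤ D) :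
    (qf (fun i => C (d i)) p).coeff (2 * D) = qf d (fun i => (p i).coeff D) := by
  unfold qf
  rw [finsetSum_coeff]
  refine Finset.sum_congr rfl fun i _ => ?_
  rw [mul_assoc, coeff_C_mul, two_mul, coeff_mul_add_eq_of_natDegree_le (h i) (h i), mul_assoc]

lemma deg_le {d : ι → F} (hd : Aniso d) (p : ι → F[X]) (D : ℕ)
    (h : (qf (fun i => C (d i)) p).natDegree ≤ 2 * D) (i : ι) : (p i).natDegree ≤ D := by
  set M := Finset.univ.sup (fun i => (p i).natDegree) with hM
  have hle : ∀ i, (p i).natDegree ≤ M := fun i =>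
    Finset.le_sup (f := fun i => (p i).natDegree) (Finset.mem_univ i)
  refine (hle i).trans ?_
  by_contra hlt
  push Not at hlt
  have h1 := coeff_qf d p M hle
  rw [coeff_eq_zero_of_natDegree_lt (by omega)] at h1
  have h2 := hd _ h1.symm
  obtain ⟨j, -, hj⟩ := Finset.exists_mem_eq_sup Finset.univ ⟨i, Finset.mem_univ i⟩
    (fun i => (p i).natDegree)
  have h3 := congrFun h2 j
  simp only [Pi.zero_apply] at h3
  rw [hM, hj] at h3
  have : p j = 0 := leadingCoeff_eq_zero.mp h3
  rw [this, natDegree_zero] at hj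
  omega

lemma poly_aniso {d : ι → F} (hd : Aniso d) : Aniso (fun i => C (d i)) := by
  intro p hp
  have h := deg_le hd p 0 (by rw [hp]; simp)
  have h1 := coeff_qf d p 0 h
  rw [hp, coeff_zero] at h1
  have h2 := hd _ h1.symm
  funext i
  rw [eq_C_of_natDegree_le_zero (h i)]
  have := congrFun h2 i
  simp only [Pi.zero_apply] at this
  simp [this]

lemma exists_denom {k : Type} [Field k] (u : ι → RatFunc k) : ∃ (f : k[X]) (p : ι → k[X]), f ≠ 0 ∧
    ∀ i, algebraMap k[X] (RatFunc k) (p i) = algebraMap k[X] (RatFunc k) f * u i := by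
  obtain ⟨b, hb⟩ := IsLocalization.exist_integer_multiples_of_finite (nonZeroDivisors k[X]) u
  choose p hp using hb
  refine ⟨b, p, nonZeroDivisors.ne_zero b.2, fun i => ?_⟩
  rw [hp i, Algebra.smul_def]

lemma algC (a : F) : algebraMap F[X] (RatFunc F) (C a) = algebraMap F (RatFunc F) a := by
  simp [RatFunc.algebraMap_eq_C]

lemma rat_aniso {d : ι → F} (hd : Aniso d) : Aniso (fun i => algebraMap F (RatFunc F) (d i)) := by
  intro u hu
  obtain ⟨f, p, hf, hp⟩ := exists_denom u
  have hf' : algebraMap F[X] (RatFunc F) f ≠ 0 := by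
    simpa using hf
  have h1 : algebraMap F[X] (RatFunc F) (qf (fun i => C (d i)) p) = 0 := by
    rw [← qf_map]
    have : (fun i => algebraMap F[X] (RatFunc F) (p i)) = algebraMap F[X] (RatFunc F) f • u := by
      funext i; simp [hp]
    rw [this, qf_smul]
    simp only [algC]
    rw [hu, mul_zero]
  have h2 : qf (fun i => C (d i)) p = 0 := by simpa using h1
  have h3 := poly_aniso hd p h2
  funext i
  have := hp i
  rw [h3] at this
  simpa [hf] using this.symm

lemma cp_poly {d : ι → F} (hd : Aniso d) (S : Set (ι → F)) (g : F[X]) :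
    ∀ (N : ℕ) (f : F[X]) (p : ι → F[X]), f.natDegree ≤ N → f ≠ 0 →
      (∀ w ∈ S, bf (fun i => C (d i)) p (fun i => C (w i)) = 0) →
      qf (fun i => C (d i)) p = f ^ 2 * g →
      ∃ p : ι → F[X], (∀ w ∈ S, bf (fun i => C (d i)) p (fun i => C (w i)) = 0) ∧
        qf (fun i => C (d i)) p = g := by
  intro N
  induction N using Nat.strong_induction_on with
  | _ N ih =>
  intro f p hN hf hS hp
  set D : ι → F[X] := fun i => C (d i) with hD
  set q : ι → F[X] := fun i => p i / f with hq
  set r : ι → F[X] := fun i => p i % f with hr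
  have hpq : p = f • q + r := by
    funext i; simp [hq, hr, EuclideanDomain.div_add_mod]
  have hrd : ∀ i, (r i).degree < f.degree := fun i => EuclideanDomain.mod_lt _ hf
  have hSr : ∀ w ∈ S, bf D q (fun i => C (w i)) = 0 ∧ bf D r (fun i => C (w i)) = 0 := by
    intro w hw
    have h := hS w hw
    rw [hpq, bf_add_left, bf_smul_left] at h
    have hdeg : (bf D r (fun i => C (w i))).degree < f.degree := by
      unfold bf
      refine lt_of_le_of_lt (degree_sum_le _ _) ?_
      rw [Finset.sup_lt_iff (bot_lt_iff_ne_bot.mpr (by simpa using hf))]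
      intro i _
      refine lt_of_le_of_lt ?_ (hrd i)
      rw [hD, mul_comm, ← mul_assoc, ← C_mul]
      by_cases h0 : w i * d i = 0
      · simp [h0]
      · rw [degree_C_mul h0]
    have hz : bf D r (fun i => C (w i)) = 0 := by
      have hdvd : f ∣ bf D r (fun i => C (w i)) :=
        ⟨- bf D q (fun i => C (w i)), by linear_combination h⟩
      exact eq_zero_of_dvd_of_degree_lt hdvd hdeg
    refine ⟨?_, hz⟩
    rw [hz, add_zero] at h
    exact (mul_eq_zero.mp h).resolve_left hf
  by_cases hr0 : r = 0
  · refine ⟨q, fun w hw => (hSr w hw).1, ?_⟩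
    rw [hpq, hr0, add_zero, qf_smul] at hp
    exact mul_left_cancel₀ (pow_ne_zero 2 hf) hp
  have hqr : qf D r ≠ 0 := fun h => hr0 (poly_aniso hd r h)
  set f' := f * qf D q - 2 * bf D p q + f * g with hf'
  have hff : qf D r = f * f' := by
    have : r = p - f • q := by rw [hpq]; simp
    rw [this, qf_sub, hp, qf_smul, bf_smul_right, hf']; ring
  have hf'0 : f' ≠ 0 := by
    rintro h; rw [h, mul_zero] at hff; exact hqr hff
  have hfpos : 0 < f.natDegree := by
    by_contra h0
    obtain ⟨i, hi⟩ := Function.ne_iff.mp hr0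
    have h1 := hrd i
    have : f.degree ≤ 0 := natDegree_eq_zero_iff_degree_le_zero.mp (by omega)
    have h2 := lt_of_lt_of_le h1 this
    exact hi (by
      by_contra h3
      exact absurd (zero_le_degree_iff.mpr h3) (not_le.mpr h2))
  have hdf : f'.natDegree < f.natDegree := by
    have h1 : (qf D r).natDegree ≤ 2 * (f.natDegree - 1) := by
      unfold qf
      refine natDegree_sum_le_of_forall_le _ _ fun i _ => ?_
      have hi : (r i).natDegree ≤ f.natDegree - 1 := by
        by_cases h0 : r i = 0
        · simp [h0]
        · have := natDegree_lt_natDegree h0 (hrd i); omega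
      have h2 : (D i * r i).natDegree ≤ (r i).natDegree := natDegree_C_mul_le _ _
      have := natDegree_mul_le (p := D i * r i) (q := r i)
      omega
    rw [hff, natDegree_mul hf hf'0] at h1
    omega
  refine ih f'.natDegree (by omega) f' ((qf D q - g) • p + (2 * (f * g - bf D p q)) • q) le_rfl hf'0
    ?_ ?_
  · intro w hw
    rw [bf_add_left, bf_smul_left, bf_smul_left, hS w hw, (hSr w hw).1]; simp
  · rw [qf_add, qf_smul, qf_smul, bf_smul_left, bf_smul_right, hp, hf']; ring

lemma cp_rat {d : ι → F} (hd : Aniso d) (S : Set (ι → F)) (b β : F) (u : ι → RatFunc F)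
    (hS : ∀ w ∈ S, bf (fun i => algebraMap F (RatFunc F) (d i)) u
      (fun i => algebraMap F (RatFunc F) (w i)) = 0)
    (hu : qf (fun i => algebraMap F (RatFunc F) (d i)) u =
      algebraMap F (RatFunc F) β + algebraMap F (RatFunc F) b * RatFunc.X ^ 2) :
    ∃ u0 u1 : ι → F, (∀ w ∈ S, bf d u0 w = 0) ∧ (∀ w ∈ S, bf d u1 w = 0) ∧
      qf d u0 = β ∧ qf d u1 = b ∧ ((2 : F) ≠ 0 → bf d u0 u1 = 0) := by
  obtain ⟨f, p, hf, hp⟩ := exists_denom u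
  have hpu : (fun i => algebraMap F[X] (RatFunc F) (p i)) = algebraMap F[X] (RatFunc F) f • u := by
    funext i; simp [hp]
  have inj : Function.Injective (algebraMap F[X] (RatFunc F)) := RatFunc.algebraMap_injective F
  obtain ⟨p, hpS, hpg⟩ := cp_poly hd S (C β + C b * X ^ 2) f.natDegree f p le_rfl hf
    (fun w hw => by
      apply inj
      rw [← bf_map, hpu, bf_smul_left]
      simp only [algC]
      rw [hS w hw]; simp)
    (by
      apply inj
      rw [← qf_map, hpu, qf_smul]
      simp only [algC]
      rw [hu]; simp)
  have hdeg := deg_le hd p 1 (by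
    rw [hpg]; compute_degree)
  have hp1 : p = (fun i => C ((p i).coeff 0)) + (X : F[X]) • (fun i => C ((p i).coeff 1)) := by
    funext i
    conv_lhs => rw [eq_X_add_C_of_natDegree_le_one (hdeg i)]
    simp; ring
  set u0 : ι → F := fun i => (p i).coeff 0
  set u1 : ι → F := fun i => (p i).coeff 1
  refine ⟨u0, u1, ?_, ?_, ?_⟩
  · intro w hw
    have h := hpS w hw
    rw [hp1, bf_add_left, bf_smul_left, bf_map, bf_map] at h
    simpa using congrArg (fun q => coeff q 0) h
  · intro w hw
    have h := hpS w hw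
    rw [hp1, bf_add_left, bf_smul_left, bf_map, bf_map] at h
    simpa [coeff_C] using congrArg (fun q => coeff q 1) h
  · rw [hp1, qf_add, qf_smul, bf_smul_right, qf_map, qf_map, bf_map] at hpg
    have h : C (qf d u0) + C (2 * bf d u0 u1) * X + C (qf d u1) * X ^ 2 = C β + C b * X ^ 2 := by
      rw [← hpg]
      simp only [C_mul, map_ofNat, u0, u1]; ring
    refine ⟨?_, ?_, ?_⟩
    · simpa [coeff_C] using congrArg (fun q => coeff q 0) h
    · simpa [coeff_C, coeff_X] using congrArg (fun q => coeff q 2) h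
    · intro h2
      simpa [coeff_C, coeff_X_pow, h2] using congrArg (fun q => coeff q 1) h
end CP

section generic

lemma reflect {F : Type} [Field F] {ι : Type} [Fintype ι] {d : ι → F}
    (hd : Aniso d) (u0 u1 v : ι → F) (hv : qf d u1 = qf d v) (h01 : bf d u0 u1 = 0) :
    ∃ u : ι → F, qf d u = qf d u0 ∧ bf d u v = 0 ∧
      ∀ w, bf d u0 w = 0 → bf d u1 w = 0 → bf d v w = 0 → bf d u w = 0 := by
  by_cases he : u1 = v
  · exact ⟨u0, rfl, he ▸ h01, fun w h _ _ => h⟩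
  have hQ : qf d (u1 - v) ≠ 0 := fun h => he (sub_eq_zero.mp (hd _ h))
  refine ⟨u0 - (2 * bf d u0 (u1 - v) / qf d (u1 - v)) • (u1 - v), ?_, ?_, ?_⟩
  · rw [qf_sub, qf_smul, bf_smul_right]; field_simp; ring
  · rw [bf_sub_left, bf_smul_left]
    have h3 : 2 * bf d (u1 - v) v = - qf d (u1 - v) := by
      rw [qf_sub, hv, bf_sub_left, bf_self]; ring
    have h4 : bf d u0 (u1 - v) = - bf d u0 v := by rw [bf_sub_right, h01]; ring
    have h5 : 2 * bf d u0 (u1 - v) / qf d (u1 - v) * bf d (u1 - v) v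
        = bf d u0 (u1 - v) * (2 * bf d (u1 - v) v) / qf d (u1 - v) := by ring
    rw [h5, h3, h4]; field_simp; ring
  · intro w a b c
    rw [bf_sub_left, bf_smul_left, bf_sub_left, a, b, c]; simp

lemma generic (k : Type) [Field k] (h2 : (2 : k) ≠ 0) (M : ℕ) :
    ∃ (F : Type) (_ : Field F) (f : k →+* F) (X : Fin M → F), (∀ i, X i ≠ 0) ∧
      (∀ (ι : Type) [Fintype ι] (d : ι → k), Aniso d → Aniso (fun i => f (d i))) ∧
      (∀ (ι : Type) [Fintype ι] (d : ι → k), Aniso d → ∀ (S : Set (ι → k)) (β : k) (b : Fin M → k)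
        (u : ι → F), (∀ w ∈ S, bf (fun i => f (d i)) u (fun i => f (w i)) = 0) →
        qf (fun i => f (d i)) u = f β + ∑ i, f (b i) * X i ^ 2 →
        ∃ (v0 : ι → k) (v : Fin M → ι → k), (∀ w ∈ S, bf d v0 w = 0) ∧
          (∀ j, ∀ w ∈ S, bf d (v j) w = 0) ∧ qf d v0 = β ∧ (∀ j, qf d (v j) = b j) ∧
          (∀ j, bf d v0 (v j) = 0) ∧ (∀ i j, i ≠ j → bf d (v i) (v j) = 0)) := by
  induction M with
  | zero =>
    refine ⟨k, inferInstance, RingHom.id k, fun i => i.elim0, fun i => i.elim0, ?_, ?_⟩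
    · intro ι _ d hd; exact hd
    · intro ι _ d hd S β b u hS hu
      refine ⟨u, fun i => i.elim0, hS, fun i => i.elim0, by simpa using hu, fun i => i.elim0,
        fun i => i.elim0, fun i => i.elim0⟩
  | succ M ih =>
    obtain ⟨F, _, f, X, hX, han, hmain⟩ := ih
    have h2F : (2 : F) ≠ 0 := by
      have := (map_ne_zero f).mpr h2; rwa [map_ofNat] at this
    refine ⟨RatFunc F, inferInstance, (algebraMap F (RatFunc F)).comp f,
      Fin.snoc (fun i => algebraMap F (RatFunc F) (X i)) RatFunc.X, ?_, ?_, ?_⟩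
    · intro i
      refine Fin.lastCases ?_ (fun i => ?_) i
      · rw [Fin.snoc_last]; exact RatFunc.X_ne_zero
      · rw [Fin.snoc_castSucc]; exact (_root_.map_ne_zero _).mpr (hX i)
    · intro ι _ d hd
      exact rat_aniso (han ι d hd)
    · intro ι _ d hd S β b u hS hu
      have hdF := han ι d hd
      obtain ⟨u0, u1, h0S, h1S, hu0, hu1, h01⟩ := cp_rat hdF ((fun w i => f (w i)) '' S)
        (f (b (Fin.last M))) (f β + ∑ i : Fin M, f (b i.castSucc) * X i ^ 2) u
        (by rintro _ ⟨w, hw, rfl⟩; exact hS w hw)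
        (by
          simp only [RingHom.comp_apply] at hu
          rw [hu, Fin.sum_univ_castSucc]
          simp only [Fin.snoc_castSucc, Fin.snoc_last, map_add, map_sum, map_mul, map_pow]
          ring)
      obtain ⟨vl, -, hvlS, -, hvl, -⟩ := hmain ι d hd S (b (Fin.last M)) 0 u1
        (fun w hw => h1S _ ⟨w, hw, rfl⟩) (by simpa using hu1)
      obtain ⟨u', hu', hu'v, hu'S⟩ := reflect hdF u0 u1 (fun i => f (vl i))
        (by rw [qf_map, hvl, hu1]) (h01 h2F)
      obtain ⟨v0, v, hv0S, hvS, hv0, hv, h0v, hvv⟩ := hmain ι d hd (insert vl S) β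
        (fun i => b i.castSucc) u'
        (by
          intro w hw
          rcases Set.mem_insert_iff.mp hw with rfl | hw
          · exact hu'v
          · exact hu'S _ (h0S _ ⟨w, hw, rfl⟩) (h1S _ ⟨w, hw, rfl⟩)
              (by rw [bf_map, hvlS w hw, map_zero]))
        (by rw [hu', hu0])
      refine ⟨v0, Fin.snoc v vl, fun w hw => hv0S w (Set.mem_insert_of_mem _ hw), ?_, hv0, ?_, ?_, ?_⟩
      · intro j
        refine Fin.lastCases ?_ (fun j => ?_) j
        · simpa using hvlS
        · simpa using fun w hw => hvS j w (Set.mem_insert_of_mem _ hw)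
      · intro j
        refine Fin.lastCases ?_ (fun j => ?_) j
        · simpa using hvl
        · simpa using hv j
      · intro j
        refine Fin.lastCases ?_ (fun j => ?_) j
        · simpa using hv0S vl (Set.mem_insert _ _)
        · simpa using h0v j
      · intro i j
        refine Fin.lastCases ?_ (fun j => ?_) j <;> refine Fin.lastCases ?_ (fun i => ?_) i
        · simp
        · simpa using hvS i vl (Set.mem_insert _ _)
        · intro _
          rw [bf_comm]
          simpa using hvS j vl (Set.mem_insert _ _)
        · intro h
          simpa using hvv i j (fun h' => h (by rw [h']))

end generic

section split
open Module

lemma finrank_map_inf {k V W : Type} [Field k] [AddCommGroup V] [Module k V] [AddCommGroup W]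
    [Module k W] [FiniteDimensional k V] (f : V →ₗ[k] W) (P : Submodule k V) :
    finrank k (P.map f) + finrank k (P ⊓ LinearMap.ker f : Submodule k V) = finrank k P := by
  have h := LinearMap.finrank_range_add_finrank_ker (f.domRestrict P)
  have h1 : LinearMap.range (f.domRestrict P) = P.map f := by
    ext x; simp
  have h2 : (LinearMap.ker (f.domRestrict P)).map P.subtype = P ⊓ LinearMap.ker f := by
    ext x; simp [and_comm]
  rw [← h1, ← h2, Submodule.finrank_map_subtype_eq]
  exact h

variable {k : Type} [Field k]

def IsSplit {ι : Type} [Fintype ι] (d : ι → k) : Prop :=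
  ∃ L : Submodule k (ι → k), (∀ v ∈ L, qf d v = 0) ∧ Fintype.card ι ≤ 2 * finrank k L

variable {ι κ : Type} [Fintype ι] [Fintype κ]

lemma IsSplit.of_lin {d : ι → k} {V : Type} [AddCommGroup V] [Module k V]
    (f : V →ₗ[k] (ι → k)) (hf : Function.Injective f) (h : ∀ x, qf d (f x) = 0)
    (hc : Fintype.card ι ≤ 2 * finrank k V) : IsSplit d := by
  refine ⟨LinearMap.range f, ?_, ?_⟩
  · rintro _ ⟨x, rfl⟩; exact h x
  · rw [LinearMap.finrank_range_of_inj hf]; exact hc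

lemma qf_sum {R : Type} [CommRing R] (d : ι → R) (e : κ → R) (v : ι ⊕ κ → R) :
    qf (Sum.elim d e) v = qf d (fun i => v (Sum.inl i)) + qf e (fun i => v (Sum.inr i)) := by
  simp [qf, Fintype.sum_sum_type]
lemma bf_sum {R : Type} [CommRing R] (d : ι → R) (e : κ → R) (v w : ι ⊕ κ → R) :
    bf (Sum.elim d e) v w = bf d (fun i => v (Sum.inl i)) (fun i => w (Sum.inl i)) +
      bf e (fun i => v (Sum.inr i)) (fun i => w (Sum.inr i)) := by
  simp [bf, Fintype.sum_sum_type]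

lemma tot_iso (h2 : (2 : k) ≠ 0) {d : ι → k} {L : Submodule k (ι → k)} (h : ∀ v ∈ L, qf d v = 0)
    {v w : ι → k} (hv : v ∈ L) (hw : w ∈ L) : bf d v w = 0 := by
  have := h _ (L.add_mem hv hw)
  rw [qf_add, h v hv, h w hw] at this
  simpa [h2] using this

def bl (d : ι → k) : LinearMap.BilinForm k (ι → k) :=
  LinearMap.mk₂ k (bf d) (fun x y z => bf_add_left d x y z) (fun a x z => bf_smul_left a d x z)
    (fun z x y => bf_add_right d x y z) (fun a z x => bf_smul_right a d x z)

lemma bf_single [DecidableEq ι] (d x : ι → k) (i : ι) : bf d x (Pi.single i 1) = d i * x i := by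
  simp [bf, Pi.single_apply]

lemma nondeg {d : ι → k} (hd : ∀ i, d i ≠ 0) {x : ι → k} (h : ∀ y, bf d x y = 0) : x = 0 := by
  classical
  funext i
  have := h (Pi.single i 1)
  rw [bf_single] at this
  simpa [hd i] using this

lemma finrank_orth {d : ι → k} (hd : ∀ i, d i ≠ 0) (A P : Submodule k (ι → k))
    (h : ∀ a ∈ A, ∀ p ∈ P, bf d a p = 0) : finrank k A + finrank k P ≤ Fintype.card ι := by
  have h1 := LinearMap.BilinForm.finrank_add_finrank_orthogonal' (B := bl d) A
  have h2 : LinearMap.ker (bl d) = ⊥ := by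
    rw [LinearMap.ker_eq_bot']
    intro x hx
    exact nondeg hd fun y => LinearMap.congr_fun hx y
  rw [h2, inf_bot_eq, finrank_bot, finrank_fintype_fun_eq_card] at h1
  have h3 : P ≤ (bl d).orthogonal A := fun p hp a ha => h a ha p hp
  have := Submodule.finrank_mono h3
  omega

lemma reduce (h2 : (2 : k) ≠ 0) {d : ι → k} {e : κ → k} (hd : ∀ i, d i ≠ 0) (he : ∀ i, e i ≠ 0)
    (L : Submodule k (ι ⊕ κ → k)) (hL : ∀ v ∈ L, qf (Sum.elim d e) v = 0)
    (M : Submodule k (κ → k)) (hM : ∀ v ∈ M, qf e v = 0) :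
    ∃ L' : Submodule k (ι → k), (∀ v ∈ L', qf d v = 0) ∧
      finrank k L + finrank k M ≤ finrank k L' + Fintype.card κ := by
  classical
  set p1 : (ι ⊕ κ → k) →ₗ[k] (ι → k) := LinearMap.funLeft k k Sum.inl with hp1
  set p2 : (ι ⊕ κ → k) →ₗ[k] (κ → k) := LinearMap.funLeft k k Sum.inr with hp2
  have sur2 : Function.Surjective p2 :=
    LinearMap.funLeft_surjective_of_injective _ _ _ Sum.inr_injective
  have hq : ∀ v, qf (Sum.elim d e) v = qf d (p1 v) + qf e (p2 v) := fun v => qf_sum d e v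
  have hb : ∀ v w, bf (Sum.elim d e) v w = bf d (p1 v) (p1 w) + bf e (p2 v) (p2 w) :=
    fun v w => bf_sum d e v w
  set M' := M.comap p2 with hM'
  set P := L ⊓ M' with hP
  refine ⟨P.map p1, ?_, ?_⟩
  · rintro _ ⟨v, ⟨hv1, hv2⟩, rfl⟩
    have := hL v hv1
    rwa [hq, hM _ hv2, add_zero] at this
  · have e1 := finrank_map_inf p1 P
    have e2 := finrank_map_inf p2 M'
    rw [Submodule.map_comap_eq_of_surjective sur2,
      inf_eq_right.mpr (fun x hx => by
        rw [LinearMap.mem_ker] at hx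
        rw [hM', Submodule.mem_comap, hx]; exact M.zero_mem)] at e2
    have e3 := LinearMap.finrank_range_add_finrank_ker p2
    rw [LinearMap.range_eq_top.mpr sur2, finrank_top, finrank_fintype_fun_eq_card,
      finrank_fintype_fun_eq_card, Fintype.card_sum] at e3
    have e4 := Submodule.finrank_sup_add_finrank_inf_eq L M'
    have e5 := finrank_orth (d := Sum.elim d e) (by rintro (i | i) <;> simp [hd, he])
      (P ⊓ LinearMap.ker p1) (L ⊔ M') (by
        rintro a ⟨⟨ha1, ha2⟩, ha3⟩ p hp
        obtain ⟨x, hx, y, hy, rfl⟩ := Submodule.mem_sup.mp hp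
        rw [bf_add_right, tot_iso h2 hL ha1 hx, hb, LinearMap.mem_ker.mp ha3, bf_zero_left,
          tot_iso h2 hM ha2 hy]; simp)
    rw [Fintype.card_sum] at e5
    rw [← hP] at e4
    omega

lemma IsSplit.cancel (h2 : (2 : k) ≠ 0) {d : ι → k} {e : κ → k} (hd : ∀ i, d i ≠ 0)
    (he : ∀ i, e i ≠ 0) (h : IsSplit (Sum.elim d e)) (h' : IsSplit e) : IsSplit d := by
  obtain ⟨L, hL, cL⟩ := h
  obtain ⟨M, hM, cM⟩ := h'
  obtain ⟨L', hL', cL'⟩ := reduce h2 hd he L hL M hM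
  refine ⟨L', hL', ?_⟩
  rw [Fintype.card_sum] at cL
  omega

lemma qf_reindex {R : Type} [CommRing R] (σ : ι ≃ κ) (d : κ → R) (v : κ → R) :
    qf (fun i => d (σ i)) (fun i => v (σ i)) = qf d v := by
  simp only [qf]
  exact Equiv.sum_comp σ (fun j => d j * v j * v j)

lemma IsSplit.reindex {e : κ → k} (h : IsSplit e) (σ : ι ≃ κ) {d : ι → k}
    (hd : ∀ i, d i = e (σ i)) : IsSplit d := by
  obtain ⟨L, hL, cL⟩ := h
  refine IsSplit.of_lin ((LinearEquiv.funCongrLeft k k σ).toLinearMap ∘ₗ L.subtype) ?_ ?_ ?_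
  · exact (LinearEquiv.injective (LinearEquiv.funCongrLeft k k σ)).comp L.injective_subtype
  · rintro ⟨x, hx⟩
    rw [funext hd, ← hL x hx]
    exact qf_reindex σ e x
  · rwa [Fintype.card_congr σ]

lemma IsSplit.sum {d : ι → k} {e : κ → k} (h : IsSplit d) (h' : IsSplit e) :
    IsSplit (Sum.elim d e) := by
  obtain ⟨L, hL, cL⟩ := h
  obtain ⟨M, hM, cM⟩ := h'
  refine IsSplit.of_lin ((LinearEquiv.sumArrowLequivProdArrow ι κ k k).symm.toLinearMap ∘ₗ
    (L.subtype.prodMap M.subtype)) ?_ ?_ ?_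
  · refine (LinearEquiv.injective (LinearEquiv.sumArrowLequivProdArrow ι κ k k).symm).comp ?_
    exact Function.Injective.prodMap L.injective_subtype M.injective_subtype
  · rintro ⟨⟨x, hx⟩, ⟨y, hy⟩⟩
    rw [qf_sum]
    have h1 := hL x hx
    have h2 := hM y hy
    simp only [LinearMap.comp_apply, LinearMap.prodMap_apply, Submodule.subtype_apply,
      LinearEquiv.coe_coe, LinearEquiv.sumArrowLequivProdArrow_symm_apply_inl,
      LinearEquiv.sumArrowLequivProdArrow_symm_apply_inr]
    change qf d x + qf e y = 0
    rw [h1, h2, add_zero]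
  · rw [finrank_prod, Fintype.card_sum]; omega

lemma IsSplit.scale {d : ι → k} (h : IsSplit d) (c : k) : IsSplit (fun i => c * d i) := by
  obtain ⟨L, hL, cL⟩ := h
  refine ⟨L, fun v hv => ?_, cL⟩
  have : qf (fun i => c * d i) v = c * qf d v := by
    simp only [qf, Finset.mul_sum]
    exact Finset.sum_congr rfl fun i _ => by ring
  rw [this, hL v hv, mul_zero]

lemma qf_neg_coef {R : Type} [CommRing R] (d v : ι → R) : qf (fun i => - d i) v = - qf d v := by
  simp [qf]

lemma IsSplit.graph {d : ι → k} {e : κ → k} (f : (ι → k) →ₗ[k] (κ → k))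
    (hf : ∀ x, qf e (f x) = qf d x) (hc : Fintype.card κ ≤ Fintype.card ι) :
    IsSplit (Sum.elim d (fun i => - e i)) := by
  refine IsSplit.of_lin ((LinearEquiv.sumArrowLequivProdArrow ι κ k k).symm.toLinearMap ∘ₗ
    (LinearMap.id.prod f)) ?_ ?_ ?_
  · refine (LinearEquiv.injective (LinearEquiv.sumArrowLequivProdArrow ι κ k k).symm).comp ?_
    intro x y h
    exact (Prod.ext_iff.mp h).1
  · intro x
    rw [qf_sum]
    change qf d x + qf (fun i => - e i) (f x) = 0
    rw [qf_neg_coef, hf]; ring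
  · rw [finrank_fintype_fun_eq_card, Fintype.card_sum]; omega

lemma IsSplit.base {K : Type} [Field K] (h2 : (2 : k) ≠ 0) (f : k →+* K) {d : ι → k}
    (h : IsSplit d) : IsSplit (fun i => f (d i)) := by
  classical
  obtain ⟨L, hL, cL⟩ := h
  set l := finrank k L
  have b := finBasis k L
  set g : (Fin l → k) →ₗ[k] (ι → k) := L.subtype ∘ₗ b.equivFun.symm.toLinearMap with hg
  have ginj : Function.Injective g := L.injective_subtype.comp (LinearEquiv.injective _)
  obtain ⟨r, hr⟩ := LinearMap.exists_leftInverse_of_injective g (LinearMap.ker_eq_bot.mpr ginj)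
  set A := LinearMap.toMatrix' g with hA
  set B := LinearMap.toMatrix' r with hB
  have hBA : B * A = 1 := by
    rw [hA, hB, ← LinearMap.toMatrix'_comp, hr, LinearMap.toMatrix'_id]
  have hgL : ∀ x, g x ∈ L := fun x => (b.equivFun.symm x).2
  have hAA : ∀ x y, bf d (g x) (g y) = 0 := fun x y => tot_iso h2 hL (hgL x) (hgL y)
  have hBA' : B.map f * A.map f = 1 := by
    rw [← Matrix.map_mul, hBA, Matrix.map_one _ (map_zero f) (map_one f)]
  refine IsSplit.of_lin (Matrix.toLin' (A.map f)) ?_ ?_ ?_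
  · intro x y hxy
    have := congrArg (Matrix.toLin' (B.map f)) hxy
    rwa [← LinearMap.comp_apply, ← LinearMap.comp_apply, ← Matrix.toLin'_mul, hBA',
      Matrix.toLin'_one] at this
  · have key : ∀ i j, ∑ t, f (d t) * f (A t i) * f (A t j) = 0 := by
      intro i j
      have := hAA (Pi.single i 1) (Pi.single j 1)
      unfold bf at this
      have h3 : ∀ t i, A t i = g (Pi.single i 1) t := by
        intro t i; rw [hA, LinearMap.toMatrix'_apply]
      simp only [← h3] at this
      simpa using congrArg f this
    intro x
    unfold qf
    simp only [Matrix.toLin'_apply, Matrix.mulVec, dotProduct, Matrix.map_apply]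
    simp only [Finset.mul_sum, Finset.sum_mul]
    rw [Finset.sum_comm]
    refine Finset.sum_eq_zero fun i _ => ?_
    rw [Finset.sum_comm]
    refine Finset.sum_eq_zero fun j _ => ?_
    have := key i j
    calc _ = (∑ t, f (d t) * f (A t i) * f (A t j)) * (x i * x j) := by
          rw [Finset.sum_mul]; exact Finset.sum_congr rfl fun t _ => by ring
      _ = 0 := by rw [this, zero_mul]
  · simpa using cL

lemma IsSplit.aniso {d : ι → k} (h : IsSplit d) (hd : Aniso d) : Fintype.card ι = 0 := by
  obtain ⟨L, hL, cL⟩ := h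
  have : L = ⊥ := by
    rw [eq_bot_iff]; intro x hx; exact hd x (hL x hx)
  rw [this, finrank_bot] at cL
  omega
end split

section pfister
open Module
variable {k : Type} [Field k]

def Dich {ι : Type} [Fintype ι] (d : ι → k) : Prop :=
  IsSplit d ∨ (Aniso d ∧ ∀ x, x ≠ 0 → ∃ A : (ι → k) →ₗ[k] (ι → k), ∀ z, qf d (A z) = qf d x * qf d z)

variable {ι κ : Type} [Fintype ι] [Fintype κ]

lemma Dich.reindex {e : κ → k} (h : Dich e) (σ : ι ≃ κ) {d : ι → k}
    (hd : ∀ i, d i = e (σ i)) : Dich d := by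
  have hd' : d = fun i => e (σ i) := funext hd
  rcases h with h | ⟨h1, h2⟩
  · exact Or.inl (h.reindex σ hd)
  · have key : ∀ x : ι → k, qf d x = qf e (fun j => x (σ.symm j)) := by
      intro x
      rw [← qf_reindex σ e, hd']
      simp
    refine Or.inr ⟨?_, ?_⟩
    · intro x hx
      rw [key] at hx
      have := h1 _ hx
      funext i
      simpa using congrFun this (σ i)
    · intro x hx
      obtain ⟨A, hA⟩ := h2 (fun j => x (σ.symm j)) (by
        intro h; apply hx; funext i; simpa using congrFun h (σ i))
      refine ⟨(LinearEquiv.funCongrLeft k k σ).toLinearMap ∘ₗ A ∘ₗ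
        (LinearEquiv.funCongrLeft k k σ.symm).toLinearMap, fun z => ?_⟩
      rw [key x, key z, ← hA, ← qf_reindex σ e, hd']
      rfl

def mk2 (f g : (ι ⊕ κ → k) →ₗ[k] (ι → k)) : (ι ⊕ κ → k) →ₗ[k] (ι ⊕ ι → k) :=
  (LinearEquiv.sumArrowLequivProdArrow ι ι k k).symm.toLinearMap ∘ₗ (f.prod g)

lemma qf_scale (d v : ι → k) (c : k) : qf (fun i => c * d i) v = c * qf d v := by
  simp only [qf, Finset.mul_sum]
  exact Finset.sum_congr rfl fun i _ => by ring

lemma qf_mk2 (d : ι → k) (a : k) (f g : (ι ⊕ κ → k) →ₗ[k] (ι → k)) (z : ι ⊕ κ → k) :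
    qf (Sum.elim d (fun i => a * d i)) (mk2 f g z) = qf d (f z) + a * qf d (g z) := by
  rw [qf_sum, qf_scale]
  rfl

lemma Dich.step {d : ι → k} (h : Dich d) {a : k} (ha : a ≠ 0) :
    Dich (Sum.elim d (fun i => a * d i)) := by
  classical
  rcases h with h | ⟨hA, hR⟩
  · exact Or.inl (h.sum (h.scale a))
  have hE : ∀ v : ι ⊕ ι → k, qf (Sum.elim d (fun i => a * d i)) v =
      qf d (fun i => v (Sum.inl i)) + a * qf d (fun i => v (Sum.inr i)) := by
    intro v; rw [qf_sum, qf_scale]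
  have inj : ∀ (c : k) (A : (ι → k) →ₗ[k] (ι → k)), c ≠ 0 → (∀ z, qf d (A z) = c * qf d z) →
      Function.Injective A := by
    intro c A hc h
    rw [injective_iff_map_eq_zero]
    intro z hz
    have := h z
    rw [hz, qf_zero] at this
    exact hA z (by simpa [hc] using this.symm)
  have nz : ∀ x, x ≠ 0 → qf d x ≠ 0 := fun x hx h => hx (hA x h)
  by_cases hiso : Aniso (Sum.elim d (fun i => a * d i))
  · refine Or.inr ⟨hiso, fun v hv => ?_⟩
    set p1 : (ι ⊕ ι → k) →ₗ[k] (ι → k) := LinearMap.funLeft k k Sum.inl with hp1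
    set p2 : (ι ⊕ ι → k) →ₗ[k] (ι → k) := LinearMap.funLeft k k Sum.inr with hp2
    have hE' : ∀ v : ι ⊕ ι → k, qf (Sum.elim d (fun i => a * d i)) v =
      qf d (p1 v) + a * qf d (p2 v) := hE
    by_cases hx : p1 v = 0
    · have hy : p2 v ≠ 0 := by
        intro hy; apply hv; funext i
        rcases i with i | i
        · exact congrFun hx i
        · exact congrFun hy i
      obtain ⟨B, hB⟩ := hR _ hy
      refine ⟨mk2 ((-a) • (B ∘ₗ p2)) (B ∘ₗ p1), fun z => ?_⟩
      rw [qf_mk2, hE' v, hE' z, hx, qf_zero]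
      simp only [LinearMap.smul_apply, LinearMap.comp_apply]
      rw [qf_smul, hB, hB]; ring
    obtain ⟨A, hA'⟩ := hR _ hx
    by_cases hy : p2 v = 0
    · refine ⟨mk2 (A ∘ₗ p1) (A ∘ₗ p2), fun z => ?_⟩
      rw [qf_mk2, hE' v, hE' z, hy, qf_zero]
      simp only [LinearMap.comp_apply]
      rw [hA', hA']; ring
    obtain ⟨B, hB⟩ := hR _ hy
    have hc := nz _ hx
    have he := nz _ hy
    set c := qf d (p1 v)
    set e := qf d (p2 v)
    set A' := LinearEquiv.ofInjectiveEndo A (inj _ A hc hA') with hAe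
    set W : (ι ⊕ ι → k) →ₗ[k] (ι → k) := A'.symm.toLinearMap ∘ₗ B ∘ₗ p2 with hW
    have hAW : ∀ z, A (W z) = B (p2 z) := by
      intro z
      have : A' (A'.symm (B (p2 z))) = B (p2 z) := A'.apply_symm_apply _
      exact this
    refine ⟨mk2 (A ∘ₗ (p1 - a • W)) (B ∘ₗ (p1 + (c / e) • W)), fun z => ?_⟩
    have hw : c * qf d (W z) = e * qf d (p2 z) := by rw [← hA', hAW, hB]
    have hw' : qf d (p2 z) = c * qf d (W z) / e := by rw [hw]; field_simp
    rw [qf_mk2, hE' v, hE' z]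
    simp only [LinearMap.comp_apply, LinearMap.sub_apply, LinearMap.add_apply, LinearMap.smul_apply]
    rw [hA', hB, qf_sub, qf_add, qf_smul, qf_smul, bf_smul_right, bf_smul_right, hw']
    change c * _ + a * (e * _) = (c + a * e) * _
    field_simp
    ring
  · left
    unfold Aniso at hiso
    push Not at hiso
    obtain ⟨v, hv0, hv⟩ := hiso
    rw [hE] at hv0
    set x : ι → k := fun i => v (Sum.inl i) with hxdef
    set y : ι → k := fun i => v (Sum.inr i) with hydef
    have hy : y ≠ 0 := by
      intro hy
      rw [hy, qf_zero, mul_zero, add_zero] at hv0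
      have hx := hA _ hv0
      apply hv; funext i
      rcases i with i | i
      · exact congrFun hx i
      · exact congrFun hy i
    have hx : x ≠ 0 := by
      intro hx
      rw [hx, qf_zero, zero_add] at hv0
      exact nz y hy ((mul_eq_zero.mp hv0).resolve_left ha)
    obtain ⟨A, hA'⟩ := hR x hx
    obtain ⟨B, hB⟩ := hR y hy
    refine IsSplit.of_lin ((LinearEquiv.sumArrowLequivProdArrow ι ι k k).symm.toLinearMap ∘ₗ
      (A.prod B)) ?_ ?_ ?_
    · refine (LinearEquiv.injective (LinearEquiv.sumArrowLequivProdArrow ι ι k k).symm).comp ?_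
      intro z w h
      exact inj _ A (nz x hx) hA' (Prod.ext_iff.mp h).1
    · intro z
      rw [hE]
      change qf d (A z) + a * qf d (B z) = 0
      rw [hA', hB]
      linear_combination qf d z * hv0
    · rw [finrank_fintype_fun_eq_card, Fintype.card_sum]; omega

def boolSplit (n : ℕ) : (Fin (n + 1) → Bool) ≃ (Fin n → Bool) ⊕ (Fin n → Bool) where
  toFun g := if g 0 then Sum.inr (fun i => g i.succ) else Sum.inl (fun i => g i.succ)
  invFun := Sum.elim (fun g => Fin.cons false g) (fun g => Fin.cons true g)
  left_inv g := by
    by_cases h : g 0 = true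
    · funext i; refine Fin.cases ?_ (fun i => ?_) i <;> simp [h]
    · funext i; refine Fin.cases ?_ (fun i => ?_) i <;> simp [h]
  right_inv g := by
    rcases g with g | g <;> simp

lemma dich_bool (n : ℕ) (a : Fin n → k) (ha : ∀ i, a i ≠ 0) :
    Dich (fun g : Fin n → Bool => ∏ i, if g i then a i else 1) := by
  induction n with
  | zero =>
    right
    refine ⟨?_, ?_⟩
    · intro x hx
      simp [qf] at hx
      funext i
      rw [Subsingleton.elim i (@default _ Unique.instInhabited)]; exact hx
    · intro x hx
      refine ⟨x (@default _ Unique.instInhabited) • LinearMap.id, fun z => ?_⟩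
      simp only [qf, Fintype.sum_unique, LinearMap.smul_apply, LinearMap.id_apply, Pi.smul_apply,
        smul_eq_mul, Finset.univ_eq_empty, Finset.prod_empty]
      ring
  | succ n ih =>
    refine ((ih (fun i => a i.succ) (fun i => ha _)).step (ha 0)).reindex (boolSplit n) ?_
    intro g
    rw [Fin.prod_univ_succ]
    rcases h : g 0 <;> simp [boolSplit, h]

def pf {n : ℕ} (a : Fin n → k) (S : Finset (Fin n)) : k := ∏ u ∈ S, a u

def finsetBool (n : ℕ) : Finset (Fin n) ≃ (Fin n → Bool) where
  toFun S i := decide (i ∈ S)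
  invFun g := Finset.univ.filter (fun i => g i = true)
  left_inv S := by ext; simp
  right_inv g := by funext; simp

lemma dich_pf {n : ℕ} (a : Fin n → k) (ha : ∀ i, a i ≠ 0) : Dich (pf a) := by
  refine (dich_bool n a ha).reindex (finsetBool n) ?_
  intro S
  simp [finsetBool, pf, Finset.prod_ite_mem]

lemma pf_split {n : ℕ} (a : Fin n → k) (ha : ∀ i, a i ≠ 0) (x : Finset (Fin n) → k) (hx : x ≠ 0)
    (h : qf (pf a) x = 0) : IsSplit (pf a) := by
  rcases dich_pf a ha with h' | ⟨h', -⟩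
  · exact h'
  · exact absurd (h' x h) hx

end pfister

section quad
open Module

lemma quad (F : Type) [Field F] (δ : F) :
    ∃ (K : Type) (_ : Field K) (f : F →+* K) (s : K), s ^ 2 = f δ ∧
      ∀ (ι : Type) [Fintype ι] (d : ι → F), Aniso d → IsSplit (fun i => f (d i)) →
        ∀ v, ∃ u, qf d u = - δ * qf d v := by
  classical
  by_cases hδ : ∃ r, r ^ 2 = δ
  · obtain ⟨r, hr⟩ := hδ
    refine ⟨F, inferInstance, RingHom.id F, r, hr, ?_⟩
    intro ι _ d hd hs v
    have := IsSplit.aniso hs hd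
    have := Fintype.card_eq_zero_iff.mp this
    exact ⟨0, by simp [qf]⟩
  · push Not at hδ
    have : Fact (∀ r : F, r ^ 2 ≠ δ + 0 * r) := ⟨fun r => by simpa using hδ r⟩
    refine ⟨QuadraticAlgebra F δ 0, inferInstance, algebraMap F _, ⟨0, 1⟩, ?_, ?_⟩
    · rw [sq, QuadraticAlgebra.algebraMap_eq]
      ext <;> simp
    intro ι _ d hd ⟨L, hL, cL⟩ v
    have hmul := finrank_mul_finrank F (QuadraticAlgebra F δ 0) L
    rw [QuadraticAlgebra.finrank_eq_two] at hmul
    let im : L →ₗ[F] (ι → F) :=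
      { toFun := fun x i => (x.1 i).im
        map_add' := fun x y => by funext i; simp
        map_smul' := fun c x => by funext i; simp }
    have key : ∀ x : ι → (QuadraticAlgebra F δ 0), (qf (fun i => algebraMap F (QuadraticAlgebra F δ 0) (d i)) x).re =
        qf d (fun i => (x i).re) + δ * qf d (fun i => (x i).im) := by
      intro x
      have : (qf (fun i => algebraMap F (QuadraticAlgebra F δ 0) (d i)) x).re =
        ∑ i, (algebraMap F (QuadraticAlgebra F δ 0) (d i) * x i * x i).re :=
          map_sum (QuadraticAlgebra.reₗ δ 0) _ _
      rw [this]
      unfold qf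
      rw [Finset.mul_sum, ← Finset.sum_add_distrib]
      refine Finset.sum_congr rfl fun i _ => ?_
      simp [QuadraticAlgebra.algebraMap_eq]
      ring
    have hinj : Function.Injective im := by
      rw [injective_iff_map_eq_zero]
      rintro ⟨x, hx⟩ h0
      have h0' : (fun i => (x i).im) = 0 := h0
      have h1 := key x
      rw [hL x hx, h0', qf_zero] at h1
      have h2 : (fun i => (x i).re) = 0 := hd _ (by simpa using h1.symm)
      apply Subtype.ext
      funext i
      exact QuadraticAlgebra.ext (congrFun h2 i) (congrFun h0' i)
    have hfin : finrank F L = finrank F (ι → F) := by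
      have := LinearMap.finrank_le_finrank_of_injective hinj
      rw [finrank_fintype_fun_eq_card] at *
      omega
    have : FiniteDimensional F L := Module.Finite.of_injective im hinj
    have hsur := (LinearMap.injective_iff_surjective_of_finrank_eq_finrank hfin).mp hinj
    obtain ⟨⟨x, hx⟩, hxv⟩ := hsur v
    have hxv' : (fun i => (x i).im) = v := hxv
    refine ⟨fun i => (x i).re, ?_⟩
    have h1 := key x
    rw [hL x hx, hxv'] at h1
    have h1' : (0 : F) = _ := h1
    linear_combination -h1'
end quad

section iso
open Module
variable {k : Type} [Field k] {ι κ μ ν : Type} [Fintype ι] [Fintype κ] [Fintype μ] [Fintype ν]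

def Iso (d : ι → k) (e : κ → k) : Prop :=
  ∃ f : (ι → k) ≃ₗ[k] (κ → k), ∀ x, qf e (f x) = qf d x

lemma diagQF_apply (d x : ι → k) : diagQF k d x = qf d x := by
  simp [diagQF, qf, QuadraticMap.weightedSumSquares_apply, mul_assoc]

lemma formIsom_iff (d : ι → k) (e : κ → k) : FormIsom k d e ↔ Iso d e := by
  constructor
  · rintro ⟨f⟩
    refine ⟨f.toLinearEquiv, fun x => ?_⟩
    rw [← diagQF_apply, ← diagQF_apply]
    exact f.map_app x
  · rintro ⟨f, hf⟩
    have h : ∀ x, diagQF k e (f x) = diagQF k d x := fun x => by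
      rw [diagQF_apply, diagQF_apply]; exact hf x
    exact ⟨⟨f, h⟩⟩

lemma Iso.symm {d : ι → k} {e : κ → k} (h : Iso d e) : Iso e d := by
  obtain ⟨f, hf⟩ := h
  exact ⟨f.symm, fun x => by rw [← hf, f.apply_symm_apply]⟩

lemma Iso.trans {d : ι → k} {e : κ → k} {g : μ → k} (h : Iso d e) (h' : Iso e g) : Iso d g := by
  obtain ⟨f, hf⟩ := h
  obtain ⟨f', hf'⟩ := h'
  exact ⟨f.trans f', fun x => by rw [← hf, ← hf']; rfl⟩

lemma Iso.refl (d : ι → k) : Iso d d := ⟨LinearEquiv.refl k _, fun _ => rfl⟩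

lemma Iso.reindex {d : ι → k} {e : κ → k} (σ : ι ≃ κ) (hd : ∀ i, d i = e (σ i)) : Iso e d := by
  refine ⟨LinearEquiv.funCongrLeft k k σ, fun x => ?_⟩
  rw [funext hd, ← qf_reindex σ e x]
  rfl

lemma Iso.sum {d : ι → k} {e : κ → k} {d' : μ → k} {e' : ν → k} (h : Iso d d') (h' : Iso e e') :
    Iso (Sum.elim d e) (Sum.elim d' e') := by
  obtain ⟨f, hf⟩ := h
  obtain ⟨f', hf'⟩ := h'
  refine ⟨(LinearEquiv.sumArrowLequivProdArrow ι κ k k).trans ((f.prodCongr f').trans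
    (LinearEquiv.sumArrowLequivProdArrow μ ν k k).symm), fun x => ?_⟩
  rw [qf_sum, qf_sum, ← hf, ← hf']
  rfl

lemma Iso.card {d : ι → k} {e : κ → k} (h : Iso d e) : Fintype.card ι = Fintype.card κ := by
  obtain ⟨f, hf⟩ := h
  simpa using f.finrank_eq

lemma Iso.ne (h2 : (2 : k) ≠ 0) {d : ι → k} {e : κ → k} (h : Iso d e) (hd : ∀ i, d i ≠ 0) (i : κ) :
    e i ≠ 0 := by
  classical
  obtain ⟨f, hf⟩ := h
  intro h0
  have hb : ∀ x y, bf e (f x) (f y) = bf d x y := by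
    intro x y
    have h1 := hf (x + y)
    rw [map_add, qf_add, qf_add, hf, hf] at h1
    have : 2 * bf e (f x) (f y) = 2 * bf d x y := by linear_combination h1
    exact mul_left_cancel₀ h2 this
  have hx : f.symm (Pi.single i 1) = 0 := by
    refine nondeg hd fun y => ?_
    rw [← hb, f.apply_symm_apply, bf_comm, bf_single, h0, zero_mul]
  have : (Pi.single i 1 : κ → k) = 0 := by simpa using hx
  simpa using congrFun this i

lemma IsSplit.iso {d : ι → k} {e : κ → k} (hs : IsSplit d) (h : Iso d e) : IsSplit e := by
  have hc := h.card
  obtain ⟨f, hf⟩ := h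
  obtain ⟨L, hL, cL⟩ := hs
  refine IsSplit.of_lin (f.toLinearMap ∘ₗ L.subtype) (f.injective.comp L.injective_subtype) ?_
    (by omega)
  rintro ⟨x, hx⟩
  rw [← hL x hx, ← hf]; rfl

lemma split_hyp (h2 : (2 : k) ≠ 0) {d : ι → k} (hd : ∀ i, d i ≠ 0) (h : ¬ Aniso d) :
    ∃ (s : ℕ) (e : Fin s → k), Iso d (Sum.elim ![1, -1] e) := by
  classical
  unfold Aniso at h
  push Not at h
  obtain ⟨x, hx, hx0⟩ := h
  obtain ⟨y, hy⟩ : ∃ y, bf d x y ≠ 0 := by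
    by_contra hcon
    push Not at hcon
    exact hx0 (nondeg hd hcon)
  obtain ⟨y1, hy1⟩ : ∃ y, bf d x y = 1 := ⟨(bf d x y)⁻¹ • y, by
    rw [bf_smul_right, inv_mul_cancel₀ hy]⟩
  obtain ⟨y2, hy2, hqy2⟩ : ∃ y, bf d x y = 1 ∧ qf d y = 0 := by
    refine ⟨y1 - (qf d y1 / 2) • x, ?_, ?_⟩
    · rw [bf_sub_right, bf_smul_right, bf_self, hx, hy1]; ring
    · rw [qf_sub, qf_smul, bf_smul_right, hx, bf_comm, hy1]; field_simp; ring
  obtain ⟨u, w, hu, hw, huw⟩ : ∃ u w, qf d u = 1 ∧ qf d w = -1 ∧ bf d u w = 0 := by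
    refine ⟨x + (1 / 2 : k) • y2, x - (1 / 2 : k) • y2, ?_, ?_, ?_⟩
    · rw [qf_add, qf_smul, bf_smul_right, hx, hy2, hqy2]; field_simp; ring
    · rw [qf_sub, qf_smul, bf_smul_right, hx, hy2, hqy2]; field_simp; ring
    · rw [bf_add_left, bf_sub_right, bf_sub_right, bf_smul_left, bf_smul_left, bf_smul_right,
        bf_smul_right, bf_self, bf_self, bf_comm d y2 x, hx, hy2, hqy2]; ring
  have hwu : bf d w u = 0 := by rw [bf_comm]; exact huw
  set W : Submodule k (ι → k) := LinearMap.ker (bl d u) ⊓ LinearMap.ker (bl d w) with hW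
  have memW : ∀ v, v ∈ W ↔ bf d u v = 0 ∧ bf d w v = 0 := fun v => Iff.rfl
  letI : Invertible (2 : k) := invertibleOfNonzero h2
  obtain ⟨e, ⟨E⟩⟩ := QuadraticForm.equivalent_weightedSumSquares ((diagQF k d).comp W.subtype)
  have hE : ∀ z, qf d (E.toLinearEquiv.symm z : ι → k) = qf e z := by
    intro z
    have h1 := E.map_app (E.toLinearEquiv.symm z)
    rw [QuadraticMap.comp_apply, diagQF_apply] at h1
    rw [← diagQF_apply e z]
    have h3 : E (E.toLinearEquiv.symm z) = z := E.toLinearEquiv.apply_symm_apply z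
    rw [h3] at h1
    exact h1.symm
  refine ⟨_, e, Iso.symm ?_⟩
  set E' := E.toLinearEquiv
  let g : (Fin 2 ⊕ Fin (finrank k W) → k) →ₗ[k] (ι → k) :=
    { toFun := fun z => z (Sum.inl 0) • u + z (Sum.inl 1) • w +
        ((E'.symm (fun i => z (Sum.inr i)) : W) : ι → k)
      map_add' := fun z z' => by
        have : (fun i => (z + z') (Sum.inr i)) =
          (fun i => z (Sum.inr i)) + (fun i => z' (Sum.inr i)) := rfl
        rw [this, map_add]
        simp only [Pi.add_apply, Submodule.coe_add]
        module
      map_smul' := fun c z => by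
        have : (fun i => (c • z) (Sum.inr i)) = c • (fun i => z (Sum.inr i)) := rfl
        rw [this, map_smul]
        simp only [Pi.smul_apply, Submodule.coe_smul, smul_eq_mul, RingHom.id_apply]
        module }
  have hg : ∀ z, g z = z (Sum.inl 0) • u + z (Sum.inl 1) • w +
        ((E'.symm (fun i => z (Sum.inr i)) : W) : ι → k) := fun z => rfl
  have hgu : ∀ z, bf d u (g z) = z (Sum.inl 0) := by
    intro z
    rw [hg, bf_add_right, bf_add_right, bf_smul_right, bf_smul_right, bf_self, hu, huw,
      ((memW _).mp (E'.symm (fun i => z (Sum.inr i))).2).1]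
    ring
  have hgw : ∀ z, bf d w (g z) = - z (Sum.inl 1) := by
    intro z
    rw [hg, bf_add_right, bf_add_right, bf_smul_right, bf_smul_right, bf_self, hw, hwu,
      ((memW _).mp (E'.symm (fun i => z (Sum.inr i))).2).2]
    ring
  have gbij : Function.Bijective g := by
    constructor
    · rw [injective_iff_map_eq_zero]
      intro z hz
      have h0 := hgu z
      have h1 := hgw z
      rw [hz, bf_zero_right] at h0 h1
      have h1' : z (Sum.inl 1) = 0 := by simpa using h1.symm
      rw [hg, ← h0, h1', zero_smul, zero_smul, zero_add, zero_add] at hz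
      have h3 : E'.symm (fun i => z (Sum.inr i)) = 0 := Subtype.ext hz
      have h4 : (fun i => z (Sum.inr i)) = 0 := by simpa using h3
      funext i
      rcases i with i | i
      · fin_cases i
        · exact h0.symm
        · exact h1'
      · exact congrFun h4 i
    · intro v
      have hm : v - bf d u v • u + bf d w v • w ∈ W := by
        rw [memW]
        constructor
        · rw [bf_add_right, bf_sub_right, bf_smul_right, bf_smul_right, bf_self, hu, huw]; ring
        · rw [bf_add_right, bf_sub_right, bf_smul_right, bf_smul_right, bf_self, hw, hwu]; ring
      refine ⟨Sum.elim ![bf d u v, - bf d w v] (E' ⟨_, hm⟩), ?_⟩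
      rw [hg]
      have : (fun i => (Sum.elim ![bf d u v, - bf d w v] (E' ⟨_, hm⟩) :
        Fin 2 ⊕ Fin (finrank k W) → k) (Sum.inr i)) = E' ⟨_, hm⟩ := rfl
      rw [this, E'.symm_apply_apply]
      simp only [Sum.elim_inl, Matrix.cons_val_zero, Matrix.cons_val_one]
      module
  refine ⟨LinearEquiv.ofBijective g gbij, fun z => ?_⟩
  rw [LinearEquiv.ofBijective_apply, hg, qf_add, qf_add, qf_smul, qf_smul, bf_smul_left,
    bf_smul_right, bf_add_left, bf_smul_left, bf_smul_left, hE, hu, hw, huw,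
    ((memW _).mp (E'.symm (fun i => z (Sum.inr i))).2).1,
    ((memW _).mp (E'.symm (fun i => z (Sum.inr i))).2).2, qf_sum]
  simp [qf, Fin.sum_univ_two]
  ring

lemma hyp_ne (m : ℕ) (i : Fin (2 * m)) : hypForm k m i ≠ 0 := by
  unfold hypForm; split_ifs <;> simp

def hypEquiv (m : ℕ) : Fin (2 * (m + 1)) ≃ Fin 2 ⊕ Fin (2 * m) :=
  (finCongr (by omega)).trans finSumFinEquiv.symm

lemma hyp_succ (m : ℕ) (i : Fin 2 ⊕ Fin (2 * m)) :
    (Sum.elim ![1, -1] (hypForm k m) : _ → k) i = hypForm k (m + 1) ((hypEquiv m).symm i) := by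
  rcases i with i | i
  · fin_cases i <;> simp [hypEquiv, hypForm]
  · simp [hypEquiv, hypForm]

lemma hyp_iso (m : ℕ) : Iso (hypForm k (m + 1)) (Sum.elim ![1, -1] (hypForm k m)) :=
  Iso.reindex (hypEquiv m).symm (hyp_succ m)

lemma split_two : IsSplit (![1, -1] : Fin 2 → k) := by
  refine IsSplit.of_lin (LinearMap.funLeft k k (fun _ : Fin 2 => ())) ?_ ?_ ?_
  · exact LinearMap.funLeft_injective_of_surjective _ _ _ (fun _ => ⟨0, rfl⟩)
  · intro x; simp [qf, LinearMap.funLeft_apply]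
  · simp

lemma split_empty [IsEmpty ι] (d : ι → k) : IsSplit d := ⟨⊥, by
  intro v hv; rw [(Submodule.mem_bot k).mp hv, qf_zero], by simp⟩

lemma hyp_split (m : ℕ) : IsSplit (hypForm k m) := by
  induction m with
  | zero => haveI : IsEmpty (Fin (2 * 0)) := Fin.isEmpty'; exact split_empty _
  | succ m ih => exact (split_two.sum ih).iso (hyp_iso m).symm

lemma witt_dec (h2 : (2 : k) ≠ 0) : ∀ (N : ℕ) (ι : Type) [Fintype ι] (d : ι → k), (∀ i, d i ≠ 0) →
    Fintype.card ι = N →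
    ∃ (m s : ℕ) (e : Fin s → k), Aniso e ∧ Iso d (Sum.elim (hypForm k m) e) := by
  intro N
  induction N using Nat.strong_induction_on with
  | _ N ih =>
  intro ι _ d hd hN
  by_cases ha : Aniso d
  · let σ := Fintype.equivFin ι
    have : IsEmpty (Fin (2 * 0)) := Fin.isEmpty'
    refine ⟨0, Fintype.card ι, fun i => d (σ.symm i), ?_, ?_⟩
    · intro x hx
      have h1 : qf d (fun i => x (σ i)) = 0 := by
        rw [← hx, ← qf_reindex σ.symm d]; simp
      have := ha _ h1
      funext i
      simpa using congrFun this (σ.symm i)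
    · refine Iso.reindex ((Equiv.emptySum _ _).trans σ.symm) ?_
      rintro (i | i)
      · exact this.elim i
      · rfl
  · obtain ⟨s, e, he⟩ := split_hyp h2 hd ha
    have hen : ∀ i, e i ≠ 0 := fun i => he.ne h2 hd (Sum.inr i)
    have hc := he.card
    simp at hc
    obtain ⟨m, s', e', hae', hi⟩ := ih s (by omega) (Fin s) e hen (by simp)
    refine ⟨m + 1, s', e', hae', ?_⟩
    refine he.trans (((Iso.refl _).sum hi).trans ?_)
    refine Iso.trans (Iso.reindex (Equiv.sumAssoc (Fin 2) (Fin (2 * m)) (Fin s'))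
      (d := Sum.elim (Sum.elim ![1, -1] (hypForm k m)) e') ?_) ((hyp_iso m).symm.sum (Iso.refl _))
    rintro ((i | i) | i) <;> rfl

lemma le_wittIndex (h2 : (2 : k) ≠ 0) {d : ι → k} (hd : ∀ i, d i ≠ 0) (L : Submodule k (ι → k))
    (hL : ∀ v ∈ L, qf d v = 0) : finrank k L ≤ wittIndex k d := by
  obtain ⟨m, s, e, hae, hi⟩ := witt_dec h2 _ ι d hd rfl
  have hi2 : Iso d (Sum.elim e (hypForm k m)) := hi.trans
    (Iso.reindex (Equiv.sumComm _ _) (by rintro (i | i) <;> rfl))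
  have hm : finrank k L ≤ m := by
    have hen : ∀ i, e i ≠ 0 := fun i => hi.ne h2 hd (Sum.inr i)
    obtain ⟨f, hf⟩ := hi2
    obtain ⟨M, hM, cM⟩ := hyp_split (k := k) m
    obtain ⟨L', hL', hc⟩ := reduce h2 hen (hyp_ne m) (L.map f.toLinearMap) (by
      rintro _ ⟨v, hv, rfl⟩
      rw [← hL v hv, ← hf]; rfl) M hM
    have : L' = ⊥ := by
      rw [eq_bot_iff]; intro x hx; exact hae x (hL' x hx)
    have h3 : finrank k (L.map f.toLinearMap) = finrank k L := LinearEquiv.finrank_map_eq f L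
    rw [this, finrank_bot, h3] at hc
    simp only [Fintype.card_fin] at hc cM
    omega
  refine hm.trans (le_csSup ⟨Fintype.card ι, ?_⟩ ⟨s, e, (formIsom_iff _ _).mpr hi⟩)
  rintro m' ⟨s', e', h'⟩
  have := ((formIsom_iff _ _).mp h').card
  simp at this
  omega
end iso

section final
open Module

noncomputable def snocEquiv (t : ℕ) (J : Type) : (Fin t × J) ⊕ J ≃ Fin (t + 1) × J :=
  Equiv.ofBijective (Sum.elim (fun p => (p.1.castSucc, p.2)) (fun j => (Fin.last t, j))) (by
    constructor
    · rintro (⟨i, j⟩ | j) (⟨i', j'⟩ | j') h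
      · simp at h
        simp [h]
      · simp only [Sum.elim_inl, Sum.elim_inr, Prod.mk.injEq] at h
        exact absurd h.1 (Fin.castSucc_lt_last i).ne
      · simp only [Sum.elim_inl, Sum.elim_inr, Prod.mk.injEq] at h
        exact absurd h.1.symm (Fin.castSucc_lt_last i').ne
      · simp at h
        simp [h]
    · rintro ⟨i, j⟩
      induction i using Fin.lastCases with
      | last => exact ⟨Sum.inr j, rfl⟩
      | cast i => exact ⟨Sum.inl (i, j), rfl⟩)

lemma indep {k : Type} [Field k] {s M : ℕ} (d : Fin s → k) (v : Fin M → Fin s → k)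
    (h0 : ∀ j, qf d (v j) ≠ 0) (ho : ∀ i j, i ≠ j → bf d (v i) (v j) = 0) : M ≤ s := by
  have : LinearIndependent k v := by
    rw [Fintype.linearIndependent_iff]
    intro g hg i
    have h1 : bl d (v i) (∑ j, g j • v j) = 0 := by rw [hg, map_zero]
    rw [map_sum, Finset.sum_eq_single i] at h1
    · have h2 : bf d (v i) (g i • v i) = 0 := h1
      rw [bf_smul_right, bf_self] at h2
      exact (mul_eq_zero.mp h2).resolve_right (h0 i)
    · intro j _ hj
      change bf d (v i) (g j • v j) = 0
      rw [bf_smul_right, ho i j (Ne.symm hj), mul_zero]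
    · intro h; exact absurd (Finset.mem_univ i) h
  simpa using this.fintype_card_le_finrank

lemma pf_ne {k : Type} [Field k] {n : ℕ} {a : Fin n → k} (ha : ∀ i, a i ≠ 0) (S : Finset (Fin n)) :
    pf a S ≠ 0 := Finset.prod_ne_zero_iff.mpr fun u _ => ha u

lemma pf_map {k K : Type} [Field k] [Field K] (h : k →+* K) {n : ℕ} (a : Fin n → k)
    (S : Finset (Fin n)) : pf (fun u => h (a u)) S = h (pf a S) := by
  simp [pf, map_prod]

theorem hs (n : ℕ) (hn : 1 ≤ n) : ∀ (t : ℕ) (k : Type) [Field k] (_ : (2 : k) ≠ 0) (ι : Type)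
    [Fintype ι] (φ : ι → k) (_ : ∀ i, φ i ≠ 0) (_ : Even (Fintype.card ι))
    (_ : Fintype.card ι < 2 ^ n) (c : Fin t → k) (a : Fin t → Fin n → k)
    (_ : ∀ i, c i ≠ 0) (_ : ∀ i u, a i u ≠ 0)
    (_ : IsSplit (Sum.elim φ (fun p : Fin t × Finset (Fin n) => c p.1 * pf (a p.1) p.2))),
    IsSplit φ := by
  intro t
  induction t with
  | zero =>
    intro k _ h2 ι _ φ hφ _ _ c a hc ha h
    exact h.cancel h2 hφ (fun p => p.1.elim0) (split_empty _)
  | succ t ih =>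
    intro k _ h2 ι _ φ hφ hev hlt c a hc ha h
    have hP : ∀ p : Fin (t + 1) × Finset (Fin n), c p.1 * pf (a p.1) p.2 ≠ 0 :=
      fun p => mul_ne_zero (hc _) (pf_ne (ha _) _)
    obtain ⟨m, s, e, hae, hi⟩ := witt_dec h2 _ ι φ hφ rfl
    have hen : ∀ i, e i ≠ 0 := fun i => hi.ne h2 hφ (Sum.inr i)
    have hcard := hi.card
    simp only [Fintype.card_sum, Fintype.card_fin] at hcard
    have he : IsSplit (Sum.elim e
        (fun p : Fin (t + 1) × Finset (Fin n) => c p.1 * pf (a p.1) p.2)) := by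
      have h1 := h.iso (hi.sum (Iso.refl _))
      refine IsSplit.cancel h2 (e := hypForm k m) ?_ (hyp_ne m) ?_ (hyp_split m)
      · rintro (i | i)
        · exact hen i
        · exact hP i
      · refine h1.reindex ((Equiv.sumComm _ _).trans (Equiv.sumAssoc _ _ _).symm) ?_
        rintro ((i | i) | i) <;> rfl
    suffices hes : IsSplit e from ((hyp_split m).sum hes).iso hi.symm
    rcases Nat.eq_zero_or_pos s with rfl | hs0
    · exact split_empty _
    exfalso
    obtain ⟨F, _, f, X, hX0, hanF, hgen⟩ := generic k h2 (2 ^ n - 1)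
    have hcJ : Fintype.card {S : Finset (Fin n) // S ≠ ∅} = 2 ^ n - 1 := by
      rw [Fintype.card_subtype_compl]
      simp
    let σ : {S : Finset (Fin n) // S ≠ ∅} ≃ Fin (2 ^ n - 1) := Fintype.equivFinOfCardEq hcJ
    set a0 := a (Fin.last t) with ha0
    obtain ⟨K, _, g, r, hr, hq⟩ := quad F
      (-∑ j : {S : Finset (Fin n) // S ≠ ∅}, f (pf a0 j) * X (σ j) ^ 2)
    let h' : k →+* K := g.comp f
    have hinj : ∀ x : k, x ≠ 0 → h' x ≠ 0 := fun x hx => (map_ne_zero h').mpr hx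
    have h2K : (2 : K) ≠ 0 := by
      have := hinj 2 h2
      rwa [map_ofNat] at this
    have hpf : IsSplit (pf (fun u => h' (a0 u))) := by
      refine pf_split _ (fun i => hinj _ (ha _ _))
        (fun S => if hS : S = ∅ then r else g (X (σ ⟨S, hS⟩))) ?_ ?_
      · intro h0
        have hne : ({⟨0, hn⟩} : Finset (Fin n)) ≠ ∅ := Finset.singleton_ne_empty _
        have h1 := congrFun h0 {⟨0, hn⟩}
        simp only [dif_neg hne, Pi.zero_apply] at h1
        exact hX0 _ ((map_eq_zero g).mp h1)
      · unfold qf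
        rw [Fintype.sum_eq_add_sum_subtype_ne _ (∅ : Finset (Fin n))]
        have h1 : ∀ j : {S : Finset (Fin n) // S ≠ ∅},
            (pf (fun u => h' (a0 u)) j.1 * (if hS : j.1 = ∅ then r else g (X (σ ⟨j.1, hS⟩))) *
              (if hS : j.1 = ∅ then r else g (X (σ ⟨j.1, hS⟩)))) =
            g (f (pf a0 j) * X (σ j) ^ 2) := by
          intro j
          rw [dif_neg j.2, pf_map]
          simp only [h', RingHom.comp_apply, map_mul, map_pow]
          ring
        rw [Finset.sum_congr rfl (fun j _ => h1 j), ← map_sum]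
        rw [map_neg] at hr
        simp only [dif_pos, pf, Finset.prod_empty]
        simp only [pf] at hr
        linear_combination hr
    have hK : IsSplit (fun i => h' (e i)) := by
      have hb := he.base h2 h'
      refine ih K h2K (Fin s) (fun i => h' (e i)) (fun i => hinj _ (hen i))
        (by simp only [Fintype.card_fin]; rw [hcard] at hev; rw [Nat.even_iff] at *; omega)
        (by simp only [Fintype.card_fin]; omega)
        (fun i => h' (c i.castSucc)) (fun i u => h' (a i.castSucc u))
        (fun i => hinj _ (hc _)) (fun i u => hinj _ (ha _ _)) ?_
      refine IsSplit.cancel h2K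
        (e := fun S => h' (c (Fin.last t)) * pf (fun u => h' (a0 u)) S) ?_ ?_ ?_ (hpf.scale _)
      · rintro (i | i)
        · exact hinj _ (hen i)
        · exact mul_ne_zero (hinj _ (hc _)) (pf_ne (fun u => hinj _ (ha _ _)) _)
      · intro S
        exact mul_ne_zero (hinj _ (hc _)) (pf_ne (fun u => hinj _ (ha _ _)) _)
      · refine hb.reindex ((Equiv.sumAssoc _ _ _).trans
          ((Equiv.refl _).sumCongr (snocEquiv t (Finset (Fin n))))) ?_
        rintro ((i | i) | i)
        · rfl
        · change _ = h' (c i.1.castSucc * pf (a i.1.castSucc) i.2)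
          rw [map_mul, ← pf_map]; rfl
        · change _ = h' (c (Fin.last t) * pf (a (Fin.last t)) i)
          rw [map_mul, ← pf_map]; rfl
    obtain ⟨u, hu⟩ := hq (Fin s) (fun i => f (e i)) (hanF _ _ hae) hK
      (Pi.single ⟨0, hs0⟩ 1)
    obtain ⟨v0, v, -, -, -, hv, -, ho⟩ := hgen (Fin s) e hae ∅ 0
      (fun i => e ⟨0, hs0⟩ * pf a0 (σ.symm i).1) u (by simp) (by
        rw [hu, ← bf_self, bf_single, map_zero, zero_add, neg_neg, Finset.sum_mul,
          ← Equiv.sum_comp σ]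
        refine Finset.sum_congr rfl fun j _ => ?_
        rw [Equiv.symm_apply_apply, map_mul]
        simp
        ring)
    have hle := indep e v (fun j => by
      rw [hv]; exact mul_ne_zero (hen _) (pf_ne (ha _) _)) ho
    have hp : 2 ^ n = 2 * 2 ^ (n - 1) := by rw [← pow_succ']; congr 1; omega
    rw [hcard, Nat.even_iff] at hev
    omega
end final
end HS

/-- **Lemma (I^n-neighbors of small dimension).**  If a regular quadratic form `q` of
dimension `m` over a field `k` of characteristic ≠ 2 is an `I^n`-neighbor of
complementary dimension `r` and `2^n > dim q + r`, then `i_W(q) ≥ (dim q - r)/2`;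
in particular, `q` is isotropic. -/
theorem statement3 (k : Type) [Field k] (hchar : ringChar k ≠ 2)
    (n : ℕ) (hn : 1 ≤ n) (m r : ℕ) (d : Fin m → k) (hreg : ∀ t, d t ≠ 0)
    (hnb : isIneighbor k n d r) (hdim : m + r < 2 ^ n) :
    (m - r) / 2 ≤ wittIndex k d ∧ ¬ (diagQF k d).Anisotropic := by
  classical
  have h2 : (2 : k) ≠ 0 := Ring.two_ne_zero hchar
  obtain ⟨hrm, σ, hσ, t, c, a, hc, ha, A, B, hiso⟩ := hnb
  rw [HS.formIsom_iff] at hiso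
  have hcard := hiso.card
  simp only [Fintype.card_sum, Fintype.card_fin, Fintype.card_prod, Fintype.card_finset] at hcard
  have hp : 2 ^ n = 2 * 2 ^ (n - 1) := by rw [← pow_succ']; congr 1; omega
  have hev : Even (m + r) := by
    have h3 : t * 2 ^ n = 2 * (t * 2 ^ (n - 1)) := by rw [hp]; ring
    rw [Nat.even_iff]; omega
  have hs : ∀ i, Sum.elim d σ i ≠ 0 := by
    rintro (i | i)
    · exact hreg i
    · exact hσ i
  have hsp : HS.IsSplit (Sum.elim d σ) := by
    refine HS.hs n hn t k h2 _ _ hs (by simpa using hev) (by simpa using hdim)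
      (fun i => - c i) a (fun i => neg_ne_zero.mpr (hc i)) ha ?_
    have hcle := hiso.card.ge
    obtain ⟨f, hf⟩ := hiso
    have h1 := HS.IsSplit.graph f.toLinearMap hf hcle
    refine HS.IsSplit.cancel h2
      (e := Sum.elim (hypForm k A) (fun i => (-1) * hypForm k B i)) ?_ ?_ ?_
      ((HS.hyp_split A).sum ((HS.hyp_split B).scale (-1)))
    · rintro (i | i)
      · exact hs i
      · exact mul_ne_zero (neg_ne_zero.mpr (hc _)) (HS.pf_ne (ha _) _)
    · rintro (i | i)
      · exact HS.hyp_ne A i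
      · exact mul_ne_zero (neg_ne_zero.mpr one_ne_zero) (HS.hyp_ne B i)
    · refine h1.reindex (Equiv.sumSumSumComm _ _ _ _) ?_
      rintro ((i | i) | (i | i))
      · rfl
      · exact neg_mul _ _
      · rfl
      · exact neg_one_mul _
  obtain ⟨L, hL, cL⟩ := hsp
  obtain ⟨L', hL', cL'⟩ := HS.reduce h2 hreg hσ L hL ⊥ (by
    intro v hv; rw [(Submodule.mem_bot k).mp hv, HS.qf_zero])
  simp only [Fintype.card_sum, Fintype.card_fin, finrank_bot] at cL cL'
  have hw := HS.le_wittIndex h2 hreg L' hL'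
  refine ⟨by omega, fun han => ?_⟩
  have hb : L' = ⊥ := by
    rw [eq_bot_iff]
    intro v hv
    exact (Submodule.mem_bot k).mpr (han v (by rw [HS.diagQF_apply]; exact hL' v hv))
  rw [hb, finrank_bot] at cL'
  omega
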